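/- Consider the quadratic function f(x) = ½xᵀAx − bᵀx on ℝⁿ with A symmetric positive definite and μI ⪯ A ⪯ LI (0 < μ ≤ L), and the SR1 iteration: G₀ = L·I, x₀ ∈ ℝⁿ, x_{k+1} = x_k − G_k⁻¹∇f(x_k), u_k = x_{k+1} − x_k, G_{k+1} = SR1(A, G_k, u_k). Then for all k ≥ 1, λ_f(x_k) ≤ (e^{(n/k)·ln(L/μ)} − 1)^{k/2} · √(L/μ) · λ_f(x_0), where λ_f(x) = √(∇f(x)ᵀA⁻¹∇f(x)). -/

import Mathlib

open Matrix

/-- The SR1 quasi-Newton update of `G` with respect to target `A` along direction `u`. -/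
noncomputable def SR1 {n : ℕ} (A G : Matrix (Fin n) (Fin n) ℝ) (u : Fin n → ℝ) :
    Matrix (Fin n) (Fin n) ℝ :=
  if (G - A) *ᵥ u = 0 then G
  else G - (u ⬝ᵥ ((G - A) *ᵥ u))⁻¹ • Matrix.vecMulVec ((G - A) *ᵥ u) ((G - A) *ᵥ u)

/-- For the quadratic f(x) = ½xᵀAx − bᵀx, the gradient norm
λ_f(x) = √(∇f(x)ᵀ A⁻¹ ∇f(x)) with ∇f(x) = Ax − b. -/
noncomputable def lamQ {n : ℕ} (A : Matrix (Fin n) (Fin n) ℝ) (b x : Fin n → ℝ) : ℝ :=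
  Real.sqrt ((A *ᵥ x - b) ⬝ᵥ (A⁻¹ *ᵥ (A *ᵥ x - b)))

section QuadraticForms

variable {n : ℕ} {A G M : Matrix (Fin n) (Fin n) ℝ}

/-- A real Hermitian matrix is symmetric as a bilinear form. -/
lemma dotProduct_mulVec_symm_of_isHermitian (hM : M.IsHermitian) (v w : Fin n → ℝ) :
    v ⬝ᵥ (M *ᵥ w) = w ⬝ᵥ (M *ᵥ v) := by
  have hT : Mᵀ = M := by simpa [Matrix.IsHermitian] using hM
  rw [dotProduct_mulVec, dotProduct_comm, ← mulVec_transpose, hT]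

lemma dotProduct_self_nonneg (v : Fin n → ℝ) : 0 ≤ v ⬝ᵥ v :=
  Finset.sum_nonneg fun i _ ↦ mul_self_nonneg (v i)

lemma dotProduct_mulVec_self_nonneg (hM : M.PosSemidef) (v : Fin n → ℝ) :
    0 ≤ v ⬝ᵥ (M *ᵥ v) := by
  simpa using hM.dotProduct_mulVec_nonneg v

/-- The Cauchy–Schwarz inequality for a positive semidefinite matrix. -/
lemma dotProduct_mulVec_sq_le (hM : M.PosSemidef) (v w : Fin n → ℝ) :
    (v ⬝ᵥ (M *ᵥ w)) ^ 2 ≤ (v ⬝ᵥ (M *ᵥ v)) * (w ⬝ᵥ (M *ᵥ w)) := by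
  have h : ∀ t : ℝ, 0 ≤ (v ⬝ᵥ (M *ᵥ v)) * (t * t) + (2 * (v ⬝ᵥ (M *ᵥ w))) * t +
      w ⬝ᵥ (M *ᵥ w) := by
    intro t
    have h0 := dotProduct_mulVec_self_nonneg hM (t • v + w)
    simp only [mulVec_add, mulVec_smul, dotProduct_add, add_dotProduct, smul_dotProduct,
      dotProduct_smul, smul_eq_mul, dotProduct_mulVec_symm_of_isHermitian hM.1 w v] at h0
    linarith
  have := discrim_le_zero h
  rw [discrim] at this
  linarith

lemma dotProduct_mulVec_self_pos (hM : M.PosSemidef) {u : Fin n → ℝ} (hu : M *ᵥ u ≠ 0) :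
    0 < u ⬝ᵥ (M *ᵥ u) := by
  refine (dotProduct_mulVec_self_nonneg hM u).lt_of_ne' fun h ↦ hu ?_
  have h1 := dotProduct_mulVec_sq_le hM (M *ᵥ u) u
  rw [h, mul_zero] at h1
  exact dotProduct_self_eq_zero.1 (pow_eq_zero_iff two_ne_zero |>.1 (h1.antisymm (sq_nonneg _)))

/-- If `M ⪯ L • 1` then `M⁻¹ ⪰ L⁻¹ • 1`. -/
lemma dotProduct_self_le_mul_inv (hM : M.PosDef) {L : ℝ}
    (hL : (L • (1 : Matrix (Fin n) (Fin n) ℝ) - M).PosSemidef) (g : Fin n → ℝ) :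
    g ⬝ᵥ g ≤ L * (g ⬝ᵥ (M⁻¹ *ᵥ g)) := by
  have hdet : IsUnit M.det := hM.det_pos.ne'.isUnit
  have hg : M *ᵥ (M⁻¹ *ᵥ g) = g := by rw [mulVec_mulVec, mul_nonsing_inv _ hdet, one_mulVec]
  have h1 := dotProduct_mulVec_sq_le hM.posSemidef g (M⁻¹ *ᵥ g)
  have h2 := dotProduct_mulVec_self_nonneg hL g
  rw [hg, dotProduct_comm (M⁻¹ *ᵥ g) g] at h1
  simp only [sub_mulVec, smul_mulVec, one_mulVec, dotProduct_sub, dotProduct_smul,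
    smul_eq_mul] at h2
  have h3 := dotProduct_mulVec_self_nonneg hM.inv.posSemidef g
  rcases (dotProduct_self_nonneg g).eq_or_lt' with h0 | h0
  · rw [dotProduct_self_eq_zero.1 h0]; simp
  · nlinarith

/-- If `M ⪰ μ • 1` with `μ > 0` then `M⁻¹ ⪯ μ⁻¹ • 1`. -/
lemma mul_inv_le_dotProduct_self (hM : M.PosDef) {μ : ℝ} (hμ : 0 < μ)
    (hlow : (M - μ • (1 : Matrix (Fin n) (Fin n) ℝ)).PosSemidef) (g : Fin n → ℝ) :
    μ * (g ⬝ᵥ (M⁻¹ *ᵥ g)) ≤ g ⬝ᵥ g := by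
  have hdet : IsUnit M.det := hM.det_pos.ne'.isUnit
  have hg : M *ᵥ (M⁻¹ *ᵥ g) = g := by rw [mulVec_mulVec, mul_nonsing_inv _ hdet, one_mulVec]
  have h1 := dotProduct_mulVec_sq_le (Matrix.PosSemidef.one (R := ℝ)) g (M⁻¹ *ᵥ g)
  have h2 := dotProduct_mulVec_self_nonneg hlow (M⁻¹ *ᵥ g)
  simp only [one_mulVec] at h1
  simp only [sub_mulVec, smul_mulVec, one_mulVec, dotProduct_sub, dotProduct_smul,
    smul_eq_mul, hg, dotProduct_comm (M⁻¹ *ᵥ g) g] at h2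
  have h3 := dotProduct_mulVec_self_nonneg hM.inv.posSemidef g
  have h4 := dotProduct_self_nonneg g
  rcases h3.eq_or_lt' with h0 | h0
  · rw [h0]; simpa
  · nlinarith [mul_le_mul_of_nonneg_left h2 h4]

/-- If `M ⪰ μ • 1` with `μ ≥ 0` then `det M ≥ μ ^ n`. -/
lemma pow_le_det (hM : M.IsHermitian) {μ : ℝ} (hμ : 0 ≤ μ)
    (hlow : (M - μ • (1 : Matrix (Fin n) (Fin n) ℝ)).PosSemidef) : μ ^ n ≤ M.det := by
  have hev : ∀ i, μ ≤ hM.eigenvalues i := by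
    intro i
    have h := dotProduct_mulVec_self_nonneg hlow (WithLp.ofLp (hM.eigenvectorBasis i))
    rw [sub_mulVec, hM.mulVec_eigenvectorBasis i, smul_mulVec, one_mulVec, ← sub_smul,
      dotProduct_smul, smul_eq_mul] at h
    have hpos : 0 < WithLp.ofLp (hM.eigenvectorBasis i) ⬝ᵥ
        WithLp.ofLp (hM.eigenvectorBasis i) := by
      refine (dotProduct_self_nonneg _).lt_of_ne' fun h0 ↦ ?_
      exact hM.eigenvectorBasis.toBasis.ne_zero i
        (by simpa using dotProduct_self_eq_zero.1 h0)
    exact sub_nonneg.1 (nonneg_of_mul_nonneg_left h hpos)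
  rw [hM.det_eq_prod_eigenvalues]
  calc μ ^ n = ∏ _i : Fin n, μ := by simp
    _ ≤ ∏ i, hM.eigenvalues i := Finset.prod_le_prod (fun _ _ ↦ hμ) fun i _ ↦ hev i
    _ = _ := by simp

lemma posDef_of_sub_posSemidef (hA : A.PosDef) (hR : (G - A).PosSemidef) : G.PosDef := by
  simpa using hA.add_posSemidef hR

/-- The SR1 update stays above its target. -/
lemma SR1_sub_posSemidef (hR : (G - A).PosSemidef) (u : Fin n → ℝ) :
    (SR1 A G u - A).PosSemidef := by
  unfold SR1
  split_ifs with h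
  · exact hR
  have hs := dotProduct_mulVec_self_pos hR h
  rw [sub_right_comm]
  refine .of_dotProduct_mulVec_nonneg (hR.1.sub ?_) fun v ↦ ?_
  · simp [Matrix.IsHermitian]
  · have hcs := dotProduct_mulVec_sq_le hR v u
    rw [sub_mulVec, smul_mulVec, vecMulVec_mulVec, star_trivial]
    simp only [dotProduct_sub, dotProduct_smul, smul_eq_mul, MulOpposite.smul_eq_mul_unop,
      MulOpposite.unop_op, dotProduct_comm ((G - A) *ᵥ u) v]
    rw [sub_nonneg, inv_mul_le_iff₀ hs]
    linarith

/-- The SR1 update of `G ⪰ A` does not exceed `G`. -/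
lemma sub_SR1_posSemidef (hR : (G - A).PosSemidef) (u : Fin n → ℝ) :
    (G - SR1 A G u).PosSemidef := by
  unfold SR1
  split_ifs with h
  · simpa using Matrix.PosSemidef.zero
  rw [sub_sub_cancel]
  exact (by simpa using posSemidef_vecMulVec_self_star ((G - A) *ᵥ u) :
    (vecMulVec ((G - A) *ᵥ u) ((G - A) *ᵥ u)).PosSemidef).smul
      (inv_nonneg.2 (dotProduct_mulVec_self_nonneg hR u))

/-- One SR1 step contracts the squared gradient norm measured in `G⁻¹` by a factor `t`
controlled by the decrease `det G = (1 + t) * det G'` of the determinant. -/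
lemma exists_SR1_contraction (hA : A.PosDef) (hR : (G - A).PosSemidef) (u : Fin n → ℝ) :
    ∃ t : ℝ, 0 ≤ t ∧ G.det = (1 + t) * (SR1 A G u).det ∧
      ((G - A) *ᵥ u) ⬝ᵥ ((SR1 A G u)⁻¹ *ᵥ ((G - A) *ᵥ u)) ≤ t * (u ⬝ᵥ (G *ᵥ u)) := by
  have hG := posDef_of_sub_posSemidef hA hR
  have hG' := posDef_of_sub_posSemidef hA (SR1_sub_posSemidef hR u)
  have hdet : IsUnit G.det := hG.det_pos.ne'.isUnit
  have hdet' : IsUnit (SR1 A G u).det := hG'.det_pos.ne'.isUnit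
  by_cases h : (G - A) *ᵥ u = 0
  · exact ⟨0, le_rfl, by simp [SR1, h], by simp [h]⟩
  have hs := dotProduct_mulVec_self_pos hR h
  have hp := dotProduct_mulVec_self_nonneg hG.inv.posSemidef ((G - A) *ᵥ u)
  have hus : u ⬝ᵥ ((G - A) *ᵥ u) ≤ u ⬝ᵥ (G *ᵥ u) := by
    have := dotProduct_mulVec_self_nonneg hA.posSemidef u
    rw [sub_mulVec, dotProduct_sub]
    linarith
  have hGH : ∀ v, G *ᵥ (G⁻¹ *ᵥ v) = v := fun v ↦ by
    rw [mulVec_mulVec, mul_nonsing_inv _ hdet, one_mulVec]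
  have hdef : SR1 A G u = G - (u ⬝ᵥ ((G - A) *ᵥ u))⁻¹ •
      vecMulVec ((G - A) *ᵥ u) ((G - A) *ᵥ u) := by simp [SR1, h]
  generalize hw : (G - A) *ᵥ u = w at *
  generalize hS : SR1 A G u = S at *
  set s := u ⬝ᵥ w with hsdef
  set p := w ⬝ᵥ (G⁻¹ *ᵥ w) with hpdef
  have hSdet : S.det = G.det * (1 - p / s) := by
    have := det_add_replicateCol_mul_replicateRow (ι := Unit) hdet (-s⁻¹ • w) w
    rw [← vecMulVec_eq, smul_vecMulVec, neg_smul, ← sub_eq_add_neg, ← hdef] at this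
    rw [this, det_unique (n := Unit)]
    congr 1
    rw [Matrix.add_apply, Matrix.mul_assoc, ← replicateCol_mulVec, replicateRow_mul_replicateCol_apply,
      mulVec_smul, dotProduct_smul, ← hpdef, one_apply_eq, smul_eq_mul]
    ring
  have hq : 0 < 1 - p / s := by
    have h1 := hG'.det_pos
    rw [hSdet] at h1
    exact pos_of_mul_pos_right h1 hG.det_pos.le
  have hq' : 0 < s - p := by
    rw [sub_pos, div_lt_one hs] at hq
    linarith
  have hSw : S *ᵥ (G⁻¹ *ᵥ w) = (1 - p / s) • w := by
    rw [hdef, sub_mulVec, smul_mulVec, vecMulVec_mulVec, hGH, sub_smul, one_smul, ← hpdef]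
    ext i
    simp
    ring
  have hSinv : S⁻¹ *ᵥ w = (1 - p / s)⁻¹ • (G⁻¹ *ᵥ w) := by
    have := congrArg (S⁻¹ *ᵥ ·) hSw
    simp only [mulVec_mulVec, ← mul_assoc, nonsing_inv_mul _ hdet', mulVec_smul] at this
    rw [one_mul] at this
    rw [this, smul_smul, inv_mul_cancel₀ hq.ne', one_smul]
  refine ⟨p / (s - p), by positivity, ?_, ?_⟩
  · rw [hSdet]
    field_simp
    ring
  · rw [hSinv, dotProduct_smul, ← hpdef, smul_eq_mul]
    calc (1 - p / s)⁻¹ * p = p / (s - p) * s := by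
          rw [one_sub_div hs.ne', inv_div]; ring
      _ ≤ _ := by gcongr

end QuadraticForms

/-- Superadditivity of the geometric mean: if `∏ (1 + tᵢ) ≤ E ^ k` then `∏ tᵢ ≤ (E - 1) ^ k`. -/
lemma one_le_and_prod_le_sub_one_pow (t : ℕ → ℝ) (ht : ∀ i, 0 ≤ t i) {k : ℕ} (hk : 1 ≤ k) {E : ℝ}
    (hE : 0 ≤ E) (h : ∏ i ∈ Finset.range k, (1 + t i) ≤ E ^ k) :
    1 ≤ E ∧ ∏ i ∈ Finset.range k, t i ≤ (E - 1) ^ k := by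
  have hk0 : (k : ℝ) ≠ 0 := by positivity
  have hw : ∑ _i ∈ Finset.range k, (1 / k : ℝ) = 1 := by simp [hk0]
  have hpos : ∀ i, 0 < 1 + t i := fun i ↦ by linarith [ht i]
  have h1 := Real.geom_mean_le_arith_mean_weighted (Finset.range k) (fun _ ↦ (1 / k : ℝ))
    (fun i ↦ 1 / (1 + t i)) (fun _ _ ↦ by positivity) hw
    (fun i _ ↦ one_div_nonneg.2 (hpos i).le)
  have h2 := Real.geom_mean_le_arith_mean_weighted (Finset.range k) (fun _ ↦ (1 / k : ℝ))
    (fun i ↦ t i / (1 + t i)) (fun _ _ ↦ by positivity) hw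
    (fun i _ ↦ div_nonneg (ht i) (hpos i).le)
  have h3 : ∑ i ∈ Finset.range k, (1 / k : ℝ) * (1 / (1 + t i)) +
      ∑ i ∈ Finset.range k, (1 / k : ℝ) * (t i / (1 + t i)) = 1 := by
    rw [← Finset.sum_add_distrib]
    refine (Finset.sum_congr rfl fun i _ ↦ ?_).trans hw
    have := (hpos i).ne'
    field_simp
  rw [Real.finsetProd_rpow _ _ (fun i _ ↦ one_div_nonneg.2 (hpos i).le),
    Finset.prod_div_distrib, Finset.prod_const_one] at h1
  rw [Real.finsetProd_rpow _ _ (fun i _ ↦ div_nonneg (ht i) (hpos i).le),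
    Finset.prod_div_distrib] at h2
  have hQ : 0 < ∏ i ∈ Finset.range k, (1 + t i) := Finset.prod_pos fun i _ ↦ hpos i
  have hP : 0 ≤ ∏ i ∈ Finset.range k, t i := Finset.prod_nonneg fun i _ ↦ ht i
  generalize ∏ i ∈ Finset.range k, (1 + t i) = Q at *
  generalize ∏ i ∈ Finset.range k, t i = P at *
  rw [Real.div_rpow zero_le_one hQ.le, Real.one_rpow] at h1
  rw [Real.div_rpow hP hQ.le] at h2
  have hQk : 0 < Q ^ (1 / k : ℝ) := Real.rpow_pos_of_pos hQ _
  have h4 : 1 + P ^ (1 / k : ℝ) ≤ Q ^ (1 / k : ℝ) := by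
    rw [← div_le_one hQk, add_div]
    linarith
  have h5 : Q ^ (1 / k : ℝ) ≤ E := by
    calc Q ^ (1 / k : ℝ) ≤ (E ^ k) ^ (1 / k : ℝ) := by gcongr
      _ = E := by rw [one_div, Real.pow_rpow_inv_natCast hE (by omega)]
  have h6 : 0 ≤ P ^ (1 / k : ℝ) := Real.rpow_nonneg hP _
  refine ⟨by linarith, ?_⟩
  calc P = (P ^ (1 / k : ℝ)) ^ k := by rw [one_div, Real.rpow_inv_natCast_pow hP (by omega)]
    _ ≤ (E - 1) ^ k := by gcongr; linarith

/-- Theorem 3.2: explicit superlinear rate of SR1 for the quadratic function,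
`λ_f(x_k) ≤ (e^{(n/k)ln(L/μ)} − 1)^{k/2} √(L/μ) λ_f(x_0)`. -/
theorem sr1_quadratic_superlinear_rate_logdet {n : ℕ}
    (A : Matrix (Fin n) (Fin n) ℝ) (b : Fin n → ℝ) (μ L : ℝ)
    (hμ : 0 < μ) (hμL : μ ≤ L) (hA : A.PosDef)
    (hlow : (A - μ • (1 : Matrix (Fin n) (Fin n) ℝ)).PosSemidef)
    (hup : (L • (1 : Matrix (Fin n) (Fin n) ℝ) - A).PosSemidef)
    (x : ℕ → Fin n → ℝ) (G : ℕ → Matrix (Fin n) (Fin n) ℝ)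
    (hG0 : G 0 = L • (1 : Matrix (Fin n) (Fin n) ℝ))
    (hx : ∀ j, x (j+1) = x j - (G j)⁻¹ *ᵥ (A *ᵥ x j - b))
    (hGS : ∀ j, G (j+1) = SR1 A (G j) (x (j+1) - x j)) :
    ∀ k : ℕ, 1 ≤ k →
      lamQ A b (x k) ≤
        (Real.exp (((n : ℝ) / (k : ℝ)) * Real.log (L / μ)) - 1) ^ ((k : ℝ) / 2) *
          Real.sqrt (L / μ) * lamQ A b (x 0) := by
  have hR : ∀ j, (G j - A).PosSemidef := by
    intro j
    induction j with
    | zero => rwa [hG0]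
    | succ j ih => rw [hGS]; exact SR1_sub_posSemidef ih _
  have hup' : ∀ j, (L • (1 : Matrix (Fin n) (Fin n) ℝ) - G j).PosSemidef := by
    intro j
    induction j with
    | zero => rw [hG0, sub_self]; exact .zero
    | succ j ih =>
      rw [hGS]
      simpa using ih.add (sub_SR1_posSemidef (hR j) (x (j + 1) - x j))
  have hGpd : ∀ j, (G j).PosDef := fun j ↦ posDef_of_sub_posSemidef hA (hR j)
  have hlow' : ∀ j, (G j - μ • (1 : Matrix (Fin n) (Fin n) ℝ)).PosSemidef := fun j ↦ by
    simpa using (hR j).add hlow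
  set g : ℕ → Fin n → ℝ := fun j ↦ A *ᵥ x j - b with hgdef
  set φ : ℕ → ℝ := fun j ↦ g j ⬝ᵥ ((G j)⁻¹ *ᵥ g j) with hφ
  have hstep : ∀ j, ∃ t : ℝ, 0 ≤ t ∧ (G j).det = (1 + t) * (G (j + 1)).det ∧
      φ (j + 1) ≤ t * φ j := by
    intro j
    obtain ⟨t, ht, hdet, hle⟩ := exists_SR1_contraction hA (hR j) (x (j + 1) - x j)
    have hu : x (j + 1) - x j = -((G j)⁻¹ *ᵥ g j) := by rw [hx]; simp [hgdef]
    have hGu : G j *ᵥ (x (j + 1) - x j) = -g j := by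
      rw [hu, mulVec_neg, mulVec_mulVec, mul_nonsing_inv _ (hGpd j).det_pos.ne'.isUnit,
        one_mulVec]
    have hg : (G j - A) *ᵥ (x (j + 1) - x j) = -g (j + 1) := by
      rw [sub_mulVec, hGu, mulVec_sub]
      simp only [hgdef]
      abel
    rw [← hGS] at hdet hle
    rw [hg, hGu, hu] at hle
    refine ⟨t, ht, hdet, ?_⟩
    simpa [hφ, mulVec_neg, dotProduct_comm ((G j)⁻¹ *ᵥ g j)] using hle
  choose t ht hdet hle using hstep
  have hL : 0 < L := hμ.trans_le hμL
  have hprod : ∀ k, (G 0).det = (∏ i ∈ Finset.range k, (1 + t i)) * (G k).det := by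
    intro k
    induction k with
    | zero => simp
    | succ k ih => rw [ih, Finset.prod_range_succ, hdet k, mul_assoc]
  have hφprod : ∀ k, φ k ≤ (∏ i ∈ Finset.range k, t i) * φ 0 := by
    intro k
    induction k with
    | zero => simp
    | succ k ih =>
      rw [Finset.prod_range_succ, mul_comm _ (t k), mul_assoc]
      exact (hle k).trans (mul_le_mul_of_nonneg_left ih (ht k))
  intro k hk
  have hk0 : (k : ℝ) ≠ 0 := by positivity
  set E := Real.exp (((n : ℝ) / (k : ℝ)) * Real.log (L / μ)) with hE
  have hEk : E ^ k = (L / μ) ^ n := by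
    rw [hE, ← Real.exp_nat_mul, ← mul_assoc, mul_div_cancel₀ _ hk0, Real.exp_nat_mul,
      Real.exp_log (div_pos hL hμ)]
  have hbound : ∏ i ∈ Finset.range k, (1 + t i) ≤ E ^ k := by
    have hP : 0 ≤ ∏ i ∈ Finset.range k, (1 + t i) :=
      Finset.prod_nonneg fun i _ ↦ by linarith [ht i]
    rw [hEk, div_pow, le_div_iff₀ (by positivity)]
    calc (∏ i ∈ Finset.range k, (1 + t i)) * μ ^ n
        ≤ (∏ i ∈ Finset.range k, (1 + t i)) * (G k).det := by
          gcongr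
          exact pow_le_det (hGpd k).1 hμ.le (hlow' k)
      _ = L ^ n := by rw [← hprod, hG0, det_smul]; simp
  obtain ⟨hE1, hPE⟩ := one_le_and_prod_le_sub_one_pow t ht hk (Real.exp_pos _).le hbound
  have hφ0 : φ 0 ≤ g 0 ⬝ᵥ (A⁻¹ *ᵥ g 0) := by
    have h1 := dotProduct_self_le_mul_inv hA hup (g 0)
    have h2 := mul_inv_le_dotProduct_self (hGpd 0) hL (by rw [hG0, sub_self]; exact .zero) (g 0)
    exact le_of_mul_le_mul_left (h2.trans h1) hL
  have hφk : g k ⬝ᵥ (A⁻¹ *ᵥ g k) ≤ L / μ * φ k := by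
    have h1 := mul_inv_le_dotProduct_self hA hμ hlow (g k)
    have h2 := dotProduct_self_le_mul_inv (hGpd k) (hup' k) (g k)
    rw [div_mul_eq_mul_div, le_div_iff₀ hμ, mul_comm]
    exact h1.trans h2
  have hE0 : 0 ≤ E - 1 := sub_nonneg.2 hE1
  have hsqrt : (E - 1) ^ ((k : ℝ) / 2) = Real.sqrt ((E - 1) ^ k) := by
    rw [Real.sqrt_eq_rpow, ← Real.rpow_natCast, ← Real.rpow_mul hE0]
    congr 1
    ring
  have hLμ : 0 ≤ L / μ := (div_pos hL hμ).le
  have h0 : 0 ≤ g 0 ⬝ᵥ (A⁻¹ *ᵥ g 0) := dotProduct_mulVec_self_nonneg hA.inv.posSemidef _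
  unfold lamQ
  rw [hsqrt, ← Real.sqrt_mul (by positivity), ← Real.sqrt_mul (by positivity)]
  apply Real.sqrt_le_sqrt
  calc g k ⬝ᵥ (A⁻¹ *ᵥ g k) ≤ L / μ * φ k := hφk
    _ ≤ L / μ * ((∏ i ∈ Finset.range k, t i) * φ 0) := by gcongr; exact hφprod k
    _ ≤ L / μ * ((E - 1) ^ k * (g 0 ⬝ᵥ (A⁻¹ *ᵥ g 0))) := by
      have := Finset.prod_nonneg (s := Finset.range k) fun i _ ↦ ht i
      refine mul_le_mul_of_nonneg_left ?_ hLμ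
      exact (mul_le_mul_of_nonneg_left hφ0 this).trans (mul_le_mul_of_nonneg_right hPE h0)
    _ = (E - 1) ^ k * (L / μ) * (g 0 ⬝ᵥ (A⁻¹ *ᵥ g 0)) := by ring
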